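/- The BMR bracket satisfies the Jacobi identity: for all smooth functions F, G, H defined on the open subset of ℝ² × ℝ^{2N} where X_i² + Y_i² > R² for all i, one has {F, {G, H}_{BMR}}_{BMR} + {G, {H, F}_{BMR}}_{BMR} + {H, {F, G}_{BMR}}_{BMR} = 0 at every point of that set; in particular the BMR bracket is a Poisson bracket. -/

import Mathlib

/-!
The BMR bracket satisfies the Jacobi identity on the open set where all vortices
lie outside the cylinder of radius `R`.
-/

open scoped BigOperators

noncomputable section

/-- Phase space for the BMR bracket: coordinates `(V₁, V₂)` together with the
vortex positions `(X₁, Y₁, …, X_N, Y_N)`. -/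
abbrev BMRSpace (N : ℕ) := (Fin 2 → ℝ) × (Fin N → ℝ × ℝ)

variable {N : ℕ}

/-- `∂F/∂V₁`. -/
def bdV1 (F : BMRSpace N → ℝ) (q : BMRSpace N) : ℝ :=
  fderiv ℝ F q (Pi.single 0 1, 0)

/-- `∂F/∂V₂`. -/
def bdV2 (F : BMRSpace N → ℝ) (q : BMRSpace N) : ℝ :=
  fderiv ℝ F q (Pi.single 1 1, 0)

/-- `∂F/∂X_i`. -/
def bdX (i : Fin N) (F : BMRSpace N → ℝ) (q : BMRSpace N) : ℝ :=
  fderiv ℝ F q (0, Pi.single i (1, 0))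

/-- `∂F/∂Y_i`. -/
def bdY (i : Fin N) (F : BMRSpace N → ℝ) (q : BMRSpace N) : ℝ :=
  fderiv ℝ F q (0, Pi.single i (0, 1))

/-- The BMR bracket, `{F, G} = Σ_{a<b} {z^a, z^b} (∂F/∂z^a ∂G/∂z^b − ∂G/∂z^a ∂F/∂z^b)`,
with the structure functions `{z^a, z^b}` given by Borisov–Mamaev–Ramodanov; all brackets
of distinct coordinate functions not listed below vanish. -/
def bmrBracket (Γ : Fin N → ℝ) (R c : ℝ) (F G : BMRSpace N → ℝ) (q : BMRSpace N) : ℝ :=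
  ((∑ i, Γ i) / c ^ 2
        - ∑ i, (Γ i / c ^ 2) * (((q.2 i).1 ^ 2 + (q.2 i).2 ^ 2) ^ 2 - R ^ 4)
            / ((q.2 i).1 ^ 2 + (q.2 i).2 ^ 2) ^ 2)
      * (bdV1 F q * bdV2 G q - bdV1 G q * bdV2 F q)
    + ∑ i,
        (((1 / c) * (((q.2 i).1 ^ 2 + (q.2 i).2 ^ 2) ^ 2
              - R ^ 2 * ((q.2 i).1 ^ 2 - (q.2 i).2 ^ 2))
              / ((q.2 i).1 ^ 2 + (q.2 i).2 ^ 2) ^ 2)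
            * (bdV1 F q * bdX i G q - bdV1 G q * bdX i F q)
        + (-(2 * R ^ 2 / c) * (q.2 i).1 * (q.2 i).2
              / ((q.2 i).1 ^ 2 + (q.2 i).2 ^ 2) ^ 2)
            * (bdV1 F q * bdY i G q - bdV1 G q * bdY i F q)
        + (-(2 * R ^ 2 / c) * (q.2 i).1 * (q.2 i).2
              / ((q.2 i).1 ^ 2 + (q.2 i).2 ^ 2) ^ 2)
            * (bdV2 F q * bdX i G q - bdV2 G q * bdX i F q)
        + ((1 / c) * (((q.2 i).1 ^ 2 + (q.2 i).2 ^ 2) ^ 2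
              + R ^ 2 * ((q.2 i).1 ^ 2 - (q.2 i).2 ^ 2))
              / ((q.2 i).1 ^ 2 + (q.2 i).2 ^ 2) ^ 2)
            * (bdV2 F q * bdY i G q - bdV2 G q * bdY i F q)
        + (-(1 / Γ i)) * (bdX i F q * bdY i G q - bdX i G q * bdY i F q))

/-- The open set of phase space on which the BMR bracket is defined: all vortices lie
strictly outside the cylinder, `X_i² + Y_i² > R²`. -/
def bmrDomain (N : ℕ) (R : ℝ) : Set (BMRSpace N) :=
  {q | ∀ i, R ^ 2 < (q.2 i).1 ^ 2 + (q.2 i).2 ^ 2}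

/-- The derivative `p ↦ dF(v)(p)` of a function `F` along a vector field `v`. -/
def alongField {E : Type*} [NormedAddCommGroup E] [NormedSpace ℝ E]
    (v : E → E) (F : E → ℝ) (p : E) : ℝ :=
  fderiv ℝ F p (v p)

/-- The bracket of the bivector field `∑ a, k a • u a ∧ w a`. -/
def frameBracket {E ι : Type*} [NormedAddCommGroup E] [NormedSpace ℝ E] [Fintype ι]
    (k : ι → ℝ) (u w : ι → E → E) (F G : E → ℝ) (p : E) : ℝ :=
  ∑ a, k a * (alongField (u a) F p * alongField (w a) G p
    - alongField (u a) G p * alongField (w a) F p)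

section Frame

variable {E ι : Type*} [NormedAddCommGroup E] [NormedSpace ℝ E]

theorem hasFDerivAt_alongField {v : E → E} {F : E → ℝ} {q : E}
    (hF : ContDiffAt ℝ 2 F q) (hv : DifferentiableAt ℝ v q) :
    HasFDerivAt (alongField v F)
      ((fderiv ℝ F q).comp (fderiv ℝ v q) + (fderiv ℝ (fderiv ℝ F) q).flip (v q)) q := by
  have h : DifferentiableAt ℝ (fderiv ℝ F) q :=
    (hF.fderiv_right (m := 1) (by norm_num)).differentiableAt (by norm_num)
  exact h.hasFDerivAt.clm_apply hv.hasFDerivAt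

theorem fderiv_alongField_comm {v x : E → E} {F : E → ℝ} {q : E}
    (hF : ContDiffAt ℝ 2 F q) (hv : DifferentiableAt ℝ v q) (hx : DifferentiableAt ℝ x q)
    (hvx : fderiv ℝ v q (x q) = fderiv ℝ x q (v q)) :
    fderiv ℝ (alongField v F) q (x q) = fderiv ℝ (alongField x F) q (v q) := by
  have hsymm : IsSymmSndFDerivAt ℝ F q := hF.isSymmSndFDerivAt (by simp)
  rw [(hasFDerivAt_alongField hF hv).fderiv, (hasFDerivAt_alongField hF hx).fderiv]
  simp [hvx, hsymm.eq (x q) (v q)]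

theorem fderiv_frameBracket [Fintype ι] {k : ι → ℝ} {u w : ι → E → E} {F G : E → ℝ} {q : E}
    (hu : ∀ a, DifferentiableAt ℝ (u a) q) (hw : ∀ a, DifferentiableAt ℝ (w a) q)
    (hF : ContDiffAt ℝ 2 F q) (hG : ContDiffAt ℝ 2 G q) (x : E) :
    fderiv ℝ (frameBracket k u w F G) q x =
      ∑ a, k a * (fderiv ℝ (alongField (u a) F) q x * alongField (w a) G q
        + alongField (u a) F q * fderiv ℝ (alongField (w a) G) q x
        - fderiv ℝ (alongField (u a) G) q x * alongField (w a) F q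
        - alongField (u a) G q * fderiv ℝ (alongField (w a) F) q x) := by
  have hd {v : E → E} {K : E → ℝ} (hK : ContDiffAt ℝ 2 K q) (hv : DifferentiableAt ℝ v q) :=
    (hasFDerivAt_alongField hK hv).differentiableAt.hasFDerivAt
  have h := HasFDerivAt.fun_sum (u := Finset.univ) fun a _ =>
    (((hd hF (hu a)).fun_mul (hd hG (hw a))).fun_sub
      ((hd hG (hu a)).fun_mul (hd hF (hw a)))).const_mul (k a)
  change fderiv ℝ (fun p => frameBracket k u w F G p) q x = _
  simp only [frameBracket]
  rw [h.fderiv]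
  simp only [sum_apply, smul_apply,
    add_apply, sub_apply, smul_eq_mul]
  exact Finset.sum_congr rfl fun a _ => by ring

theorem sum_sum_eq_zero_of_antisymm [Fintype ι] (T : ι → ι → ℝ)
    (hT : ∀ a b, T a b + T b a = 0) : ∑ a, ∑ b, T a b = 0 := by
  have h : ∑ a, ∑ b, T a b + ∑ a, ∑ b, T b a = 0 := by
    simp [← Finset.sum_add_distrib, hT]
  rw [Finset.sum_comm (f := fun a b => T b a)] at h
  linarith

/-- The bracket of a bivector field with constant coefficients in a commuting frame satisfies
the Jacobi identity. -/
theorem frameBracket_jacobi [Fintype ι] {k : ι → ℝ} {u w : ι → E → E} {F G H : E → ℝ} {q : E}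
    (hu : ∀ a, DifferentiableAt ℝ (u a) q) (hw : ∀ a, DifferentiableAt ℝ (w a) q)
    (huu : ∀ a b, fderiv ℝ (u a) q (u b q) = fderiv ℝ (u b) q (u a q))
    (huw : ∀ a b, fderiv ℝ (u a) q (w b q) = fderiv ℝ (w b) q (u a q))
    (hww : ∀ a b, fderiv ℝ (w a) q (w b q) = fderiv ℝ (w b) q (w a q))
    (hF : ContDiffAt ℝ 2 F q) (hG : ContDiffAt ℝ 2 G q) (hH : ContDiffAt ℝ 2 H q) :
    frameBracket k u w F (frameBracket k u w G H) q
      + frameBracket k u w G (frameBracket k u w H F) q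
      + frameBracket k u w H (frameBracket k u w F G) q = 0 := by
  have cuu {K : E → ℝ} (hK : ContDiffAt ℝ 2 K q) (a b : ι) :=
    fderiv_alongField_comm hK (hu a) (hu b) (huu a b)
  have cuw {K : E → ℝ} (hK : ContDiffAt ℝ 2 K q) (a b : ι) :=
    fderiv_alongField_comm hK (hu a) (hw b) (huw a b)
  have cww {K : E → ℝ} (hK : ContDiffAt ℝ 2 K q) (a b : ι) :=
    fderiv_alongField_comm hK (hw a) (hw b) (hww a b)
  have expand {K L M : E → ℝ} (hL : ContDiffAt ℝ 2 L q) (hM : ContDiffAt ℝ 2 M q) :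
      frameBracket k u w K (frameBracket k u w L M) q = ∑ a, ∑ b, k a * k b *
        (alongField (u a) K q *
          (fderiv ℝ (alongField (u b) L) q (w a q) * alongField (w b) M q
            + alongField (u b) L q * fderiv ℝ (alongField (w b) M) q (w a q)
            - fderiv ℝ (alongField (u b) M) q (w a q) * alongField (w b) L q
            - alongField (u b) M q * fderiv ℝ (alongField (w b) L) q (w a q))
        - alongField (w a) K q *
          (fderiv ℝ (alongField (u b) L) q (u a q) * alongField (w b) M q
            + alongField (u b) L q * fderiv ℝ (alongField (w b) M) q (u a q)
            - fderiv ℝ (alongField (u b) M) q (u a q) * alongField (w b) L q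
            - alongField (u b) M q * fderiv ℝ (alongField (w b) L) q (u a q))) := by
    refine Finset.sum_congr rfl fun a _ => ?_
    rw [alongField.eq_1 (w a) (frameBracket k u w L M),
      alongField.eq_1 (u a) (frameBracket k u w L M),
      fderiv_frameBracket hu hw hL hM, fderiv_frameBracket hu hw hL hM, Finset.mul_sum,
      Finset.sum_mul, ← Finset.sum_sub_distrib, Finset.mul_sum]
    exact Finset.sum_congr rfl fun b _ => by ring
  rw [expand hG hH, expand hH hF, expand hF hG]
  simp only [← Finset.sum_add_distrib]
  refine sum_sum_eq_zero_of_antisymm _ fun a b => ?_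
  rw [cuu hF b a, cuu hG b a, cuu hH b a, cww hF b a, cww hG b a, cww hH b a,
    cuw hF a b, cuw hG a b, cuw hH a b, cuw hF b a, cuw hG b a, cuw hH b a]
  ring

end Frame

/-- The field `∂_h + dψ(h) ∂_{V₁} + dφ(h) ∂_{V₂}` moving the `i`-th vortex in the direction `h`,
for potentials `ψ, φ` depending on the position of that vortex only. -/
def shearField (i : Fin N) (ψ φ : ℝ × ℝ → ℝ) (h : ℝ × ℝ) (p : BMRSpace N) : BMRSpace N :=
  fderiv ℝ ψ (p.2 i) h • (Pi.single 0 1, 0) + fderiv ℝ φ (p.2 i) h • (Pi.single 1 1, 0)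
    + (0, Pi.single i h)

theorem shearField_snd (i : Fin N) (ψ φ : ℝ × ℝ → ℝ) (h : ℝ × ℝ) (p : BMRSpace N) :
    (shearField i ψ φ h p).2 = Pi.single i h := by
  simp [shearField]

theorem hasFDerivAt_shearField (i : Fin N) {ψ φ : ℝ × ℝ → ℝ} (h : ℝ × ℝ) {q : BMRSpace N}
    (hψ : ContDiffAt ℝ 2 ψ (q.2 i)) (hφ : ContDiffAt ℝ 2 φ (q.2 i)) :
    ∃ L : BMRSpace N →L[ℝ] BMRSpace N, HasFDerivAt (shearField i ψ φ h) L q ∧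
      ∀ x, L x = fderiv ℝ (fderiv ℝ ψ) (q.2 i) (x.2 i) h • (Pi.single 0 1, 0)
        + fderiv ℝ (fderiv ℝ φ) (q.2 i) (x.2 i) h • (Pi.single 1 1, 0) := by
  have hev : HasFDerivAt (fun p : BMRSpace N => p.2 i)
      ((ContinuousLinearMap.proj i).comp (ContinuousLinearMap.snd ℝ _ _)) q :=
    ((ContinuousLinearMap.proj (R := ℝ) (φ := fun _ : Fin N => ℝ × ℝ) i).comp
      (ContinuousLinearMap.snd ℝ (Fin 2 → ℝ) (Fin N → ℝ × ℝ))).hasFDerivAt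
  have key {χ : ℝ × ℝ → ℝ} (hχ : ContDiffAt ℝ 2 χ (q.2 i)) :=
    ((((hχ.fderiv_right (m := 1) (by norm_num)).differentiableAt
      (by norm_num)).hasFDerivAt.comp q hev).clm_apply (hasFDerivAt_const h q))
  refine ⟨_, (((key hψ).smul_const _).add ((key hφ).smul_const _)).add_const _, fun x => ?_⟩
  simp

theorem fderiv_shearField_comm {ψ φ : Fin N → ℝ × ℝ → ℝ} {q : BMRSpace N}
    (hψ : ∀ i, ContDiffAt ℝ 2 (ψ i) (q.2 i)) (hφ : ∀ i, ContDiffAt ℝ 2 (φ i) (q.2 i))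
    (i j : Fin N) (h h' : ℝ × ℝ) :
    fderiv ℝ (shearField i (ψ i) (φ i) h) q (shearField j (ψ j) (φ j) h' q) =
      fderiv ℝ (shearField j (ψ j) (φ j) h') q (shearField i (ψ i) (φ i) h q) := by
  obtain ⟨L, hL, hLx⟩ := hasFDerivAt_shearField i h (hψ i) (hφ i)
  obtain ⟨L', hL', hLx'⟩ := hasFDerivAt_shearField j h' (hψ j) (hφ j)
  rw [hL.fderiv, hL'.fderiv, hLx, hLx', shearField_snd, shearField_snd]
  by_cases hij : i = j
  · subst hij
    have sψ : IsSymmSndFDerivAt ℝ (ψ i) (q.2 i) := (hψ i).isSymmSndFDerivAt (by simp)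
    have sφ : IsSymmSndFDerivAt ℝ (φ i) (q.2 i) := (hφ i).isSymmSndFDerivAt (by simp)
    simp [sψ.eq h h', sφ.eq h h']
  · simp [Pi.single_eq_of_ne hij, Pi.single_eq_of_ne (Ne.symm hij)]

theorem alongField_shearField (i : Fin N) (ψ φ : ℝ × ℝ → ℝ) (h : ℝ × ℝ) (F : BMRSpace N → ℝ)
    (p : BMRSpace N) :
    alongField (shearField i ψ φ h) F p =
      fderiv ℝ ψ (p.2 i) h * bdV1 F p + fderiv ℝ φ (p.2 i) h * bdV2 F p
        + fderiv ℝ F p (0, Pi.single i h) := by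
  simp only [alongField, shearField, map_add, map_smul, smul_eq_mul, bdV1, bdV2]

/-- The potential `k (l z - R² l z / |z|²)`; for `l` a coordinate this is the momentum carried by
a vortex at `z` outside the cylinder. -/
def vortexPotential (k R : ℝ) (l : ℝ × ℝ →L[ℝ] ℝ) (z : ℝ × ℝ) : ℝ :=
  k * (l z - R ^ 2 * l z / (z.1 ^ 2 + z.2 ^ 2))

theorem contDiffAt_vortexPotential (k R : ℝ) (l : ℝ × ℝ →L[ℝ] ℝ) {z : ℝ × ℝ}
    (hz : z.1 ^ 2 + z.2 ^ 2 ≠ 0) : ContDiffAt ℝ 2 (vortexPotential k R l) z := by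
  unfold vortexPotential
  fun_prop (disch := exact hz)

theorem fderiv_vortexPotential (k R : ℝ) (l : ℝ × ℝ →L[ℝ] ℝ) {z : ℝ × ℝ}
    (hz : z.1 ^ 2 + z.2 ^ 2 ≠ 0) (h : ℝ × ℝ) :
    fderiv ℝ (vortexPotential k R l) z h =
      k * (l h - R ^ 2 * (l h * (z.1 ^ 2 + z.2 ^ 2) - l z * (2 * z.1 * h.1 + 2 * z.2 * h.2))
        / (z.1 ^ 2 + z.2 ^ 2) ^ 2) := by
  have hl : HasFDerivAt (fun z => l z) l z := l.hasFDerivAt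
  have hden : HasFDerivAt (fun z : ℝ × ℝ => z.1 ^ 2 + z.2 ^ 2) _ z :=
    ((hasFDerivAt_fst (𝕜 := ℝ) (p := z)).pow 2).add ((hasFDerivAt_snd (𝕜 := ℝ) (p := z)).pow 2)
  have hinv : HasFDerivAt (fun z : ℝ × ℝ => (z.1 ^ 2 + z.2 ^ 2)⁻¹) _ z :=
    (hasDerivAt_inv hz).comp_hasFDerivAt z hden
  have hpot := (hl.fun_sub ((hl.const_mul (R ^ 2)).fun_mul hinv)).const_mul k
  have heq : vortexPotential k R l =
      fun z => k * (l z - R ^ 2 * l z * (z.1 ^ 2 + z.2 ^ 2)⁻¹) := by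
    funext z
    rw [vortexPotential, div_eq_mul_inv]
  rw [heq, hpot.fderiv]
  simp [-mul_eq_mul_left_iff]
  field_simp
  ring

/-- The fields `∂_{V₁}` and `∂/∂X_i` in the coordinates straightening the BMR bracket. -/
def bmrFrameX (Γ : Fin N → ℝ) (R c : ℝ) : Option (Fin N) → BMRSpace N → BMRSpace N
  | none => fun _ => (Pi.single 0 1, 0)
  | some i => shearField i (vortexPotential (Γ i / c) R (ContinuousLinearMap.snd ℝ ℝ ℝ))
      (vortexPotential (-(Γ i / c)) R (ContinuousLinearMap.fst ℝ ℝ ℝ)) (1, 0)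

/-- The fields `∂_{V₂}` and `∂/∂Y_i` in the coordinates straightening the BMR bracket. -/
def bmrFrameY (Γ : Fin N → ℝ) (R c : ℝ) : Option (Fin N) → BMRSpace N → BMRSpace N
  | none => fun _ => (Pi.single 1 1, 0)
  | some i => shearField i (vortexPotential (Γ i / c) R (ContinuousLinearMap.snd ℝ ℝ ℝ))
      (vortexPotential (-(Γ i / c)) R (ContinuousLinearMap.fst ℝ ℝ ℝ)) (0, 1)

/-- The constant coefficients of the BMR bracket in its straightening frame. -/
def bmrCoeff (Γ : Fin N → ℝ) (c : ℝ) : Option (Fin N) → ℝ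
  | none => (∑ i, Γ i) / c ^ 2
  | some i => -(1 / Γ i)

theorem normSq_ne_zero_of_mem_bmrDomain {R : ℝ} {p : BMRSpace N} (hp : p ∈ bmrDomain N R)
    (i : Fin N) : (p.2 i).1 ^ 2 + (p.2 i).2 ^ 2 ≠ 0 :=
  ((sq_nonneg R).trans_lt (hp i)).ne'

theorem isOpen_bmrDomain (N : ℕ) (R : ℝ) : IsOpen (bmrDomain N R) := by
  simp only [bmrDomain, Set.ofPred_forall]
  exact isOpen_iInter_of_finite fun i => isOpen_lt (by fun_prop) (by fun_prop)

theorem bmrBracket_eq_frameBracket {Γ : Fin N → ℝ} (hΓ : ∀ i, Γ i ≠ 0) {R c : ℝ} (hc : c ≠ 0)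
    (F G : BMRSpace N → ℝ) {p : BMRSpace N} (hp : p ∈ bmrDomain N R) :
    bmrBracket Γ R c F G p =
      frameBracket (bmrCoeff Γ c) (bmrFrameX Γ R c) (bmrFrameY Γ R c) F G p := by
  rw [frameBracket, Fintype.sum_option, bmrBracket, sub_mul, Finset.sum_mul,
    sub_add_eq_add_sub, add_sub_assoc, ← Finset.sum_sub_distrib]
  refine congrArg₂ (· + ·) rfl (Finset.sum_congr rfl fun i _ => ?_)
  have hz := normSq_ne_zero_of_mem_bmrDomain hp i
  have hi := hΓ i
  simp only [bmrCoeff, bmrFrameX, bmrFrameY, alongField_shearField,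
    fderiv_vortexPotential _ _ _ hz, ContinuousLinearMap.coe_fst', ContinuousLinearMap.coe_snd',
    ← bdX.eq_1, ← bdY.eq_1]
  field_simp
  ring

/-- The BMR bracket satisfies the Jacobi identity: for all functions
smooth on the open set where `X_i² + Y_i² > R²` for all `i`, the cyclic sum of double
brackets vanishes at every point of that set. -/
theorem bmrBracket_jacobi {N : ℕ} (hN : 1 ≤ N)
    (Γ : Fin N → ℝ) (hΓ : ∀ i, Γ i ≠ 0) (R c : ℝ) (hR : 0 < R) (hc : 0 < c)
    (F G H : BMRSpace N → ℝ)
    (hF : ContDiffOn ℝ (⊤ : ℕ∞) F (bmrDomain N R))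
    (hG : ContDiffOn ℝ (⊤ : ℕ∞) G (bmrDomain N R))
    (hH : ContDiffOn ℝ (⊤ : ℕ∞) H (bmrDomain N R))
    (q : BMRSpace N) (hq : q ∈ bmrDomain N R) :
    bmrBracket Γ R c F (bmrBracket Γ R c G H) q
      + bmrBracket Γ R c G (bmrBracket Γ R c H F) q
      + bmrBracket Γ R c H (bmrBracket Γ R c F G) q = 0 := by
  have hU := isOpen_bmrDomain N R
  have hnhds := hU.mem_nhds hq
  have outer (K L M : BMRSpace N → ℝ) :
      bmrBracket Γ R c K (bmrBracket Γ R c L M) q =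
        frameBracket (bmrCoeff Γ c) (bmrFrameX Γ R c) (bmrFrameY Γ R c) K
          (frameBracket (bmrCoeff Γ c) (bmrFrameX Γ R c) (bmrFrameY Γ R c) L M) q := by
    have heq : bmrBracket Γ R c L M =ᶠ[nhds q]
        frameBracket (bmrCoeff Γ c) (bmrFrameX Γ R c) (bmrFrameY Γ R c) L M := by
      filter_upwards [hnhds] with p hp using bmrBracket_eq_frameBracket hΓ hc.ne' L M hp
    rw [bmrBracket_eq_frameBracket hΓ hc.ne' _ _ hq]
    simp only [frameBracket.eq_1 _ _ _ K, alongField.eq_1 _ (bmrBracket Γ R c L M),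
      alongField.eq_1 _ (frameBracket _ _ _ L M), heq.fderiv_eq]
  have hpot (k : ℝ) (l : ℝ × ℝ →L[ℝ] ℝ) (i : Fin N) :
      ContDiffAt ℝ 2 (vortexPotential k R l) (q.2 i) :=
    contDiffAt_vortexPotential k R l (normSq_ne_zero_of_mem_bmrDomain hq i)
  have hcomm := fderiv_shearField_comm (fun i => hpot (Γ i / c) (.snd ℝ ℝ ℝ) i)
    (fun i => hpot (-(Γ i / c)) (.fst ℝ ℝ ℝ) i)
  have hdiff (i : Fin N) (h : ℝ × ℝ) := (hasFDerivAt_shearField i h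
    (hpot (Γ i / c) (.snd ℝ ℝ ℝ) i) (hpot (-(Γ i / c)) (.fst ℝ ℝ ℝ) i))
  have hzero (i : Fin N) (h : ℝ × ℝ) (v : Fin 2 → ℝ) : fderiv ℝ (shearField i
      (vortexPotential (Γ i / c) R (.snd ℝ ℝ ℝ)) (vortexPotential (-(Γ i / c)) R (.fst ℝ ℝ ℝ)) h)
      q (v, 0) = 0 := by
    obtain ⟨L, hL, hLx⟩ := hdiff i h
    simp [hL.fderiv, hLx]
  have hC2 {K : BMRSpace N → ℝ} (hK : ContDiffOn ℝ (⊤ : ℕ∞) K (bmrDomain N R)) :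
      ContDiffAt ℝ 2 K q := (contDiffOn_infty.1 hK 2).contDiffAt hnhds
  have hd (i : Fin N) (h : ℝ × ℝ) := (hdiff i h).choose_spec.1.differentiableAt
  rw [outer, outer, outer]
  refine frameBracket_jacobi ?_ ?_ ?_ ?_ ?_ (hC2 hF) (hC2 hG) (hC2 hH)
  · rintro (_ | i)
    exacts [differentiableAt_const _, hd i _]
  · rintro (_ | i)
    exacts [differentiableAt_const _, hd i _]
  all_goals
    rintro (_ | i) (_ | j)
    · simp [bmrFrameX, bmrFrameY]
    · simp [bmrFrameX, bmrFrameY, hzero]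
    · simp [bmrFrameX, bmrFrameY, hzero]
    · exact hcomm i j _ _

end
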